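/- arXiv:1103.4018 — 2 statements merged into one kernel-verified Lean document; each statement's English description precedes it below -/
import Mathlib

section
/- The function m ↦ e^{−m} · Σ_{k ≥ 6m} k² mᵏ/k! (the sum running over all natural numbers k with k ≥ 6m) is bounded on [0, ∞), and it tends to 0 as m → ∞. Equivalently, if N_m is a Poisson random variable with mean m, then E[N_m² · 1_{N_m ≥ 6m}] is bounded uniformly in m ≥ 0 and tends to 0 as m → ∞. -/
open Filter

theorem sq_le_four_mul_two_pow (k : ℕ) : (k : ℝ) ^ 2 ≤ 4 * 2 ^ k := by
  suffices h : k ^ 2 ≤ 4 * 2 ^ k by exact_mod_cast h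
  have h : k < 2 * 2 ^ (k / 2) := by
    have := (k / 2).lt_two_pow_self
    omega
  calc k ^ 2 ≤ (2 * 2 ^ (k / 2)) ^ 2 := Nat.pow_le_pow_left h.le 2
    _ = 4 * 2 ^ (k / 2 * 2) := by rw [mul_pow, ← pow_mul]; norm_num
    _ ≤ 4 * 2 ^ k := by gcongr <;> omega

theorem exp_four_mul_le_two_pow {m : ℝ} {k : ℕ} (hk : 6 * m ≤ k) :
    Real.exp (4 * m) ≤ 2 ^ k := by
  rw [← Real.exp_log (two_pos : (0 : ℝ) < 2), ← Real.exp_nat_mul, Real.exp_le_exp]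
  have : (k : ℝ) * (2 / 3) ≤ k * Real.log 2 := by
    gcongr
    linarith [Real.log_two_gt_d9]
  linarith

/-- A Chernoff bound for the terms of the truncated second moment of a Poisson variable. -/
theorem sq_mul_pow_div_factorial_le {m : ℝ} {k : ℕ} (hm : 0 ≤ m) (hk : 6 * m ≤ k) :
    (k : ℝ) ^ 2 * m ^ k / (k.factorial : ℝ) ≤
      4 * Real.exp (-(4 * m)) * ((4 * m) ^ k / (k.factorial : ℝ)) := by
  have h : 1 ≤ Real.exp (-(4 * m)) * 2 ^ k := by
    rw [Real.exp_neg, inv_mul_eq_div, one_le_div (Real.exp_pos _)]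
    exact exp_four_mul_le_two_pow hk
  rw [← mul_div_assoc]
  refine div_le_div_of_nonneg_right ?_ (Nat.cast_nonneg _)
  calc (k : ℝ) ^ 2 * m ^ k ≤ 4 * 2 ^ k * m ^ k * 1 := by
        rw [mul_one]
        gcongr
        exact sq_le_four_mul_two_pow k
    _ ≤ 4 * 2 ^ k * m ^ k * (Real.exp (-(4 * m)) * 2 ^ k) := by gcongr
    _ = 4 * Real.exp (-(4 * m)) * (4 * m) ^ k := by
        rw [mul_pow, show (4 : ℝ) = 2 * 2 by norm_num, mul_pow]
        ring

theorem abs_poisson_truncated_second_moment_le {m : ℝ} (hm : 0 ≤ m) :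
    |Real.exp (-m) *
        ∑' k : ℕ, (if 6 * m ≤ (k : ℝ) then (k : ℝ) ^ 2 * m ^ k / (Nat.factorial k : ℝ)
          else 0)| ≤ 4 * Real.exp (-m) := by
  have hsum : HasSum (fun k : ℕ ↦ 4 * Real.exp (-(4 * m)) * ((4 * m) ^ k / (k.factorial : ℝ)))
      4 := by
    have h := (NormedSpace.expSeries_div_hasSum_exp (4 * m)).mul_left
      (4 * Real.exp (-(4 * m)))
    rwa [← Real.exp_eq_exp_ℝ, mul_assoc, ← Real.exp_add, neg_add_cancel, Real.exp_zero,
      mul_one] at h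
  have hbound := tsum_of_norm_bounded hsum (f := fun k : ℕ ↦
      if 6 * m ≤ (k : ℝ) then (k : ℝ) ^ 2 * m ^ k / (Nat.factorial k : ℝ) else 0) fun k ↦ by
    split_ifs with hk
    · rw [Real.norm_of_nonneg (by positivity)]
      exact sq_mul_pow_div_factorial_le hm hk
    · rw [norm_zero]
      positivity
  rw [abs_mul, Real.abs_exp, mul_comm]
  exact mul_le_mul_of_nonneg_right hbound (Real.exp_pos _).le

/-- The function `m ↦ e^{−m} ∑_{k ≥ 6m} k² mᵏ/k!` (i.e. `E[N_m² 1_{N_m ≥ 6m}]` for a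
Poisson random variable `N_m` of mean `m`) is bounded on `[0, ∞)` and tends to `0`
as `m → ∞`. -/
theorem stmt_4 :
    (∃ C : ℝ, ∀ m : ℝ, 0 ≤ m →
        |Real.exp (-m) *
            ∑' k : ℕ, (if 6 * m ≤ (k : ℝ) then (k : ℝ) ^ 2 * m ^ k / (Nat.factorial k : ℝ)
              else 0)| ≤ C) ∧
      Tendsto (fun m : ℝ =>
          Real.exp (-m) *
            ∑' k : ℕ, (if 6 * m ≤ (k : ℝ) then (k : ℝ) ^ 2 * m ^ k / (Nat.factorial k : ℝ)
              else 0))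
        atTop (nhds 0) := by
  refine ⟨⟨4, fun m hm ↦ (abs_poisson_truncated_second_moment_le hm).trans ?_⟩, ?_⟩
  · linarith [Real.exp_le_one_iff.2 (neg_nonpos.2 hm)]
  · refine squeeze_zero_norm' (a := fun m ↦ 4 * Real.exp (-m)) ?_ ?_
    · filter_upwards [eventually_ge_atTop 0] with m hm
      exact abs_poisson_truncated_second_moment_le hm
    · simpa using Real.tendsto_exp_neg_atTop_nhds_zero.const_mul 4
end

section
/- For every φ ∈ C_c^∞(ℝ, ℂ): lim_{t→0⁺} ∫_ℝ ∫_ℝ | d²/dx² [ (e^{x y − x² t} − 1) φ(x) ] |² dx dγ_t(y) = 0, where for each fixed y the second derivative is taken in the variable x. -/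
open MeasureTheory ProbabilityTheory Filter

/-- The product-rule expansion of `d²/dx² [(e^{x y − x² t} − 1) φ(x)]`. -/
theorem iteratedDeriv_two_exp_sub_one_mul {φ : ℝ → ℂ} (hφ : ContDiff ℝ (⊤ : ℕ∞) φ) (t y x : ℝ) :
    iteratedDeriv 2 (fun x : ℝ => ((Real.exp (x * y - x ^ 2 * t) : ℂ) - 1) * φ x) x =
      ((((y - 2 * x * t) ^ 2 - 2 * t) * Real.exp (x * y - x ^ 2 * t) : ℝ) : ℂ) * φ x +
        2 * (((y - 2 * x * t) * Real.exp (x * y - x ^ 2 * t) : ℝ) : ℂ) * deriv φ x +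
        ((Real.exp (x * y - x ^ 2 * t) - 1 : ℝ) : ℂ) * deriv (deriv φ) x := by
  have hφ₀ : ∀ x, HasDerivAt φ (deriv φ x) x := fun x =>
    (hφ.differentiable (by simp) x).hasDerivAt
  have hφ₁ : ∀ x, HasDerivAt (deriv φ) (deriv (deriv φ) x) x := fun x =>
    (((contDiff_infty_iff_deriv.1 hφ).2).differentiable (by simp) x).hasDerivAt
  have hlin : ∀ x : ℝ, HasDerivAt (fun x : ℝ => y - 2 * x * t) (-2 * t) x := fun x => by
    have := (((hasDerivAt_id x).const_mul 2).mul_const t).const_sub y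
    simpa using this
  have hexp : ∀ x : ℝ, HasDerivAt (fun x : ℝ => Real.exp (x * y - x ^ 2 * t))
      ((y - 2 * x * t) * Real.exp (x * y - x ^ 2 * t)) x := fun x => by
    have := (((hasDerivAt_id x).mul_const y).sub ((hasDerivAt_pow 2 x).mul_const t)).exp
    refine this.congr_deriv ?_
    simp
    ring
  have hfirst : deriv (fun x : ℝ => ((Real.exp (x * y - x ^ 2 * t) : ℂ) - 1) * φ x) =
      fun x : ℝ => (((y - 2 * x * t) * Real.exp (x * y - x ^ 2 * t) : ℝ) : ℂ) * φ x +
        ((Real.exp (x * y - x ^ 2 * t) : ℂ) - 1) * deriv φ x := by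
    funext x
    exact (((hexp x).ofReal_comp.sub_const 1).mul (hφ₀ x)).deriv
  rw [iteratedDeriv_succ, iteratedDeriv_one, hfirst]
  have h₁ := ((hlin x).mul (hexp x)).ofReal_comp.mul (hφ₀ x)
  have h₂ := ((hexp x).ofReal_comp.sub_const 1).mul (hφ₁ x)
  refine ((h₁.add h₂).congr_deriv ?_).deriv
  push_cast
  simp only [Pi.mul_apply]
  push_cast
  ring

/-- Bounds on `e^{x y − x² t} − 1` and its first two `x`-derivatives for `y = s z`, `t = s²`. -/
theorem exp_flow_coeff_bounds {R s x z : ℝ} (hR : 1 ≤ R) (hs : 0 ≤ s) (hs1 : s ≤ 1)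
    (hx : |x| ≤ R) :
    |((s * z - 2 * x * s ^ 2) ^ 2 - 2 * s ^ 2) * Real.exp (x * (s * z) - x ^ 2 * s ^ 2)| ≤
        6 * R ^ 2 * s * (|z| + 1) ^ 2 * Real.exp (R ^ 2 * (|z| + 1)) ∧
      |(s * z - 2 * x * s ^ 2) * Real.exp (x * (s * z) - x ^ 2 * s ^ 2)| ≤
        2 * R ^ 2 * s * (|z| + 1) ^ 2 * Real.exp (R ^ 2 * (|z| + 1)) ∧
      |Real.exp (x * (s * z) - x ^ 2 * s ^ 2) - 1| ≤
        R ^ 2 * s * (|z| + 1) ^ 2 * Real.exp (R ^ 2 * (|z| + 1)) := by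
  set w := |z| + 1 with hw
  have hz := abs_nonneg z
  have hw1 : 1 ≤ w := by linarith
  have hww : w ≤ w ^ 2 := by nlinarith
  have hRR : R ≤ R ^ 2 := by nlinarith
  have hss : s ^ 2 ≤ s := by nlinarith
  have hu : |x * (s * z) - x ^ 2 * s ^ 2| ≤ R ^ 2 * s * w := by
    calc |x * (s * z) - x ^ 2 * s ^ 2| ≤ |x * (s * z)| + |x ^ 2 * s ^ 2| := abs_sub _ _
      _ = |x| * (s * |z|) + |x| ^ 2 * s ^ 2 := by simp [abs_mul, abs_of_nonneg hs]
      _ ≤ R ^ 2 * (s * |z|) + R ^ 2 * s := by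
        gcongr
        exact hx.trans hRR
      _ = R ^ 2 * s * w := by rw [hw]; ring
  have hv : |s * z - 2 * x * s ^ 2| ≤ 2 * R * s * w := by
    calc |s * z - 2 * x * s ^ 2| ≤ |s * z| + |2 * x * s ^ 2| := abs_sub _ _
      _ = s * |z| + 2 * |x| * s ^ 2 := by simp [abs_mul, abs_of_nonneg hs]
      _ ≤ (2 * R) * (s * |z|) + 2 * R * s := by
        refine add_le_add (le_mul_of_one_le_left (by positivity) (by linarith)) ?_
        gcongr
      _ = 2 * R * s * w := by rw [hw]; ring
  have huw : |x * (s * z) - x ^ 2 * s ^ 2| ≤ R ^ 2 * w :=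
    hu.trans (by
      gcongr
      exact mul_le_of_le_one_right (by positivity) hs1)
  have hE : Real.exp (x * (s * z) - x ^ 2 * s ^ 2) ≤ Real.exp (R ^ 2 * w) :=
    Real.exp_le_exp.2 ((le_abs_self _).trans huw)
  refine ⟨?_, ?_, ?_⟩
  · rw [abs_mul, Real.abs_exp]
    gcongr
    calc |(s * z - 2 * x * s ^ 2) ^ 2 - 2 * s ^ 2|
        ≤ |s * z - 2 * x * s ^ 2| ^ 2 + |2 * s ^ 2| := by
          rw [← abs_pow]; exact abs_sub _ _
      _ = |s * z - 2 * x * s ^ 2| ^ 2 + 2 * (s ^ 2 * (1 * 1)) := by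
          rw [abs_of_nonneg (by positivity : 0 ≤ 2 * s ^ 2)]; ring
      _ ≤ (2 * R * s * w) ^ 2 + 2 * (s ^ 2 * (R ^ 2 * w ^ 2)) := by
          gcongr <;> nlinarith
      _ = 6 * R ^ 2 * s ^ 2 * w ^ 2 := by ring
      _ ≤ 6 * R ^ 2 * s * w ^ 2 := by gcongr
  · rw [abs_mul, Real.abs_exp]
    gcongr
    exact hv.trans (by gcongr)
  · have hexp : ∀ u : ℝ, |Real.exp u - 1| ≤ |u| * Real.exp |u| := fun u => by
      rcases le_total 0 u with h | h
      · rw [abs_of_nonneg h, abs_of_nonneg (by linarith [Real.one_le_exp h])]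
        have h₁ := Real.add_one_le_exp (-u)
        have h₂ : Real.exp (-u) * Real.exp u = 1 := by rw [← Real.exp_add]; simp
        nlinarith [Real.exp_pos u]
      · rw [abs_of_nonpos h, abs_of_nonpos (by linarith [Real.exp_le_one_iff.2 h])]
        nlinarith [Real.add_one_le_exp u, Real.one_le_exp (neg_nonneg.2 h)]
    refine (hexp _).trans ?_
    gcongr
    exact hu.trans (by gcongr)

theorem norm_iteratedDeriv_two_exp_sub_one_mul_le {φ : ℝ → ℂ} (hφ : ContDiff ℝ (⊤ : ℕ∞) φ)
    {M R s x z : ℝ} (hR : 1 ≤ R) (hs : 0 ≤ s) (hs1 : s ≤ 1) (hx : |x| ≤ R)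
    (h₀ : ‖φ x‖ ≤ M) (h₁ : ‖deriv φ x‖ ≤ M) (h₂ : ‖deriv (deriv φ) x‖ ≤ M) :
    ‖iteratedDeriv 2 (fun x : ℝ =>
        ((Real.exp (x * (s * z) - x ^ 2 * s ^ 2 : ℝ) : ℂ) - 1) * φ x) x‖ ≤
      11 * R ^ 2 * M * s * Real.exp ((R ^ 2 + 2) * (|z| + 1)) := by
  have hM : 0 ≤ M := (norm_nonneg _).trans h₀
  obtain ⟨b₀, b₁, b₂⟩ := exp_flow_coeff_bounds (z := z) hR hs hs1 hx
  rw [iteratedDeriv_two_exp_sub_one_mul hφ]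
  refine (norm_add₃_le).trans ?_
  simp only [norm_mul, Complex.norm_real, Real.norm_eq_abs, Complex.norm_ofNat] at b₀ b₁ b₂ ⊢
  set w := |z| + 1 with hw
  have hwpos : 0 ≤ w := by positivity
  have hwexp : w ≤ Real.exp w := by linarith [Real.add_one_le_exp w]
  have hsplit : Real.exp ((R ^ 2 + 2) * w) = Real.exp w ^ 2 * Real.exp (R ^ 2 * w) := by
    rw [← Real.exp_nat_mul, ← Real.exp_add]
    congr 1
    push_cast
    ring
  rw [← abs_mul, ← abs_mul]
  calc _ ≤ (6 * R ^ 2 * s * w ^ 2 * Real.exp (R ^ 2 * w)) * M +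
        2 * (2 * R ^ 2 * s * w ^ 2 * Real.exp (R ^ 2 * w)) * M +
        (R ^ 2 * s * w ^ 2 * Real.exp (R ^ 2 * w)) * M := by gcongr
    _ = 11 * R ^ 2 * M * s * (w ^ 2 * Real.exp (R ^ 2 * w)) := by ring
    _ ≤ _ := by
      rw [hsplit]
      gcongr

theorem integrable_exp_mul_abs_gaussianReal (c : ℝ) :
    Integrable (fun z : ℝ => Real.exp (c * (|z| + 1))) (gaussianReal 0 1) := by
  have h := ((integrable_exp_mul_gaussianReal (μ := 0) (v := 1) c).add
    (integrable_exp_mul_gaussianReal (μ := 0) (v := 1) (-c))).mul_const (Real.exp c)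
  refine h.mono' (by fun_prop) (ae_of_all _ fun z => ?_)
  rw [Real.norm_eq_abs, Real.abs_exp, mul_add, mul_one, Real.exp_add]
  simp only [Pi.add_apply]
  gcongr
  rcases abs_cases z with ⟨h, _⟩ | ⟨h, _⟩ <;> rw [h]
  · linarith [Real.exp_pos (-c * z)]
  · rw [mul_neg, ← neg_mul]
    linarith [Real.exp_pos (c * z)]

/-- Substitution `y = √t z` in an integral against a centred Gaussian of variance `t`. -/
theorem integral_gaussianReal_eq_integral_sqrt_mul {E : Type*} [NormedAddCommGroup E]
    [NormedSpace ℝ E] {t : ℝ} (ht : 0 < t) (f : ℝ → E) :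
    ∫ y, f y ∂(gaussianReal 0 t.toNNReal) = ∫ z, f (√t * z) ∂(gaussianReal 0 1) := by
  have hmap : (gaussianReal 0 1).map (√t * ·) = gaussianReal 0 t.toNNReal := by
    rw [gaussianReal_map_const_mul]
    congr 1
    · simp
    · ext
      simp [Real.sq_sqrt ht.le, ht.le]
  rw [← hmap, (measurableEmbedding_mulLeft₀ (Real.sqrt_pos.2 ht).ne').integral_map]

/-- Verification of Condition (I) for the Schrödinger Hamiltonian: for every
`φ ∈ C_c^∞(ℝ, ℂ)`,
`∫∫ |d²/dx² [(e^{x y − x² t} − 1) φ(x)]|² dx dγ_t(y) → 0` as `t → 0⁺`. -/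
theorem stmt_11 (φ : ℝ → ℂ) (hφ : ContDiff ℝ (⊤ : ℕ∞) φ) (hsupp : HasCompactSupport φ) :
    Tendsto (fun t : ℝ =>
        ∫ y, (∫ x, ‖iteratedDeriv 2
              (fun x : ℝ => ((Real.exp (x * y - x ^ 2 * t) : ℂ) - 1) * φ x) x‖ ^ 2)
          ∂(gaussianReal 0 t.toNNReal))
      (nhdsWithin 0 (Set.Ioi 0)) (nhds 0) := by
  have hφ₁ := (contDiff_infty_iff_deriv.1 hφ).2
  have hφ₂ := (contDiff_infty_iff_deriv.1 hφ₁).2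
  obtain ⟨M₀, hM₀⟩ := hsupp.exists_bound_of_continuous hφ.continuous
  obtain ⟨M₁, hM₁⟩ := hsupp.deriv.exists_bound_of_continuous hφ₁.continuous
  obtain ⟨M₂, hM₂⟩ := hsupp.deriv.deriv.exists_bound_of_continuous hφ₂.continuous
  set M := max M₀ (max M₁ M₂)
  obtain ⟨R, hR, hsub⟩ : ∃ R : ℝ, 1 ≤ R ∧ tsupport φ ⊆ Metric.closedBall 0 R := by
    obtain ⟨r, hr⟩ := hsupp.isCompact.isBounded.subset_closedBall 0
    exact ⟨max 1 r, le_max_left _ _, hr.trans (Metric.closedBall_subset_closedBall (le_max_right _ _))⟩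
  set K : ℝ := 2 * R * (11 * R ^ 2 * M) ^ 2
  set c : ℝ := 2 * (R ^ 2 + 2)
  have hinner : ∀ t : ℝ, 0 < t → t ≤ 1 → ∀ z : ℝ,
      ∫ x, ‖iteratedDeriv 2 (fun x : ℝ =>
        ((Real.exp (x * (√t * z) - x ^ 2 * t : ℝ) : ℂ) - 1) * φ x) x‖ ^ 2 ≤
      t * (K * Real.exp (c * (|z| + 1))) := by
    intro t ht ht1 z
    set B : ℝ := 11 * R ^ 2 * M * √t * Real.exp ((R ^ 2 + 2) * (|z| + 1)) with hB
    have hpt : ∀ x : ℝ, ‖iteratedDeriv 2 (fun x : ℝ =>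
        ((Real.exp (x * (√t * z) - x ^ 2 * t : ℝ) : ℂ) - 1) * φ x) x‖ ^ 2 ≤
        (Set.Icc (-R) R).indicator (fun _ => B ^ 2) x := by
      intro x
      by_cases hx : x ∈ Set.Icc (-R) R
      · rw [Set.indicator_of_mem hx]
        gcongr
        have h := norm_iteratedDeriv_two_exp_sub_one_mul_le hφ (M := M) (z := z) hR
          (Real.sqrt_nonneg t) (Real.sqrt_le_one.2 ht1) (abs_le.2 hx)
          ((hM₀ x).trans (le_max_left _ _))
          ((hM₁ x).trans ((le_max_left _ _).trans (le_max_right _ _)))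
          ((hM₂ x).trans ((le_max_right _ _).trans (le_max_right _ _)))
        rwa [Real.sq_sqrt ht.le] at h
      · have hxs : x ∉ tsupport φ := fun h => hx (by
          simpa [Real.norm_eq_abs, abs_le] using hsub h)
        have hxs₁ : x ∉ tsupport (deriv φ) := fun h => hxs (tsupport_deriv_subset h)
        have hxs₂ : x ∉ tsupport (deriv (deriv φ)) := fun h => hxs₁ (tsupport_deriv_subset h)
        rw [Set.indicator_of_notMem hx, iteratedDeriv_two_exp_sub_one_mul hφ,
          image_eq_zero_of_notMem_tsupport hxs, image_eq_zero_of_notMem_tsupport hxs₁,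
          image_eq_zero_of_notMem_tsupport hxs₂]
        simp
    calc _ ≤ ∫ x, (Set.Icc (-R) R).indicator (fun _ => B ^ 2) x := by
          refine integral_mono_of_nonneg (ae_of_all _ fun x => by positivity) ?_
            (ae_of_all _ hpt)
          exact (integrable_indicator_iff measurableSet_Icc).2 (by simp)
      _ = 2 * R * B ^ 2 := by
          rw [integral_indicator measurableSet_Icc, setIntegral_const, Real.volume_real_Icc_of_le
            (by linarith), smul_eq_mul]
          ring
      _ = _ := by
          rw [hB, mul_pow, mul_pow, Real.sq_sqrt ht.le, ← Real.exp_nat_mul]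
          simp only [K, c]
          push_cast
          ring_nf
  have hlim : Tendsto (fun t : ℝ => t * ∫ z, K * Real.exp (c * (|z| + 1)) ∂(gaussianReal 0 1))
      (nhdsWithin 0 (Set.Ioi 0)) (nhds 0) := by
    have : Tendsto (fun t : ℝ => t * ∫ z, K * Real.exp (c * (|z| + 1)) ∂(gaussianReal 0 1))
        (nhds 0) (nhds 0) := Continuous.tendsto' (by fun_prop) _ _ (by simp)
    exact this.mono_left nhdsWithin_le_nhds
  refine squeeze_zero' (Eventually.of_forall fun t => ?_) ?_ hlim
  · exact integral_nonneg fun y => integral_nonneg fun x => by positivity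
  · filter_upwards [Ioc_mem_nhdsGT (zero_lt_one' ℝ)] with t ht
    rw [integral_gaussianReal_eq_integral_sqrt_mul ht.1, ← integral_const_mul]
    refine integral_mono_of_nonneg (ae_of_all _ fun z => integral_nonneg fun x => by positivity)
      (((integrable_exp_mul_abs_gaussianReal c).const_mul K).const_mul t)
      (ae_of_all _ fun z => hinner t ht.1 ht.2 z)
end
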